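/- arXiv:2411.02825 — 11 statements merged into one kernel-verified Lean document; each statement's English description precedes it below -/
import Mathlib

section
/- Let r ∈ (0,1) satisfy (r/2)^2 = 1 - r (i.e. r = 2(√2 - 1)). Then for every positive integer m and every real N > 0, the level-m criticality equation 2^m · log((r/2)^m · N) = log N + Σ_{j=1}^m 2^{j-1} · log((r/2)^{j-1} · (1-r) · N) holds. In particular the critical ratio r is independent of the level m. -/
open Real Finset in
/-- If `r ∈ (0,1)` satisfies `(r/2)^2 = 1 - r`, then for every positive integer `m`
and every real `N > 0`, the level-`m` criticality equation holds. -/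
theorem stmt1 (r : ℝ) (hr : r ∈ Set.Ioo (0:ℝ) 1) (hcrit : (r/2)^2 = 1 - r) :
    ∀ m : ℕ, 0 < m → ∀ N : ℝ, 0 < N →
      (2:ℝ)^m * Real.log ((r/2)^m * N) =
        Real.log N + ∑ j ∈ Finset.Icc 1 m,
          (2:ℝ)^(j-1) * Real.log ((r/2)^(j-1) * (1 - r) * N) := by
  obtain ⟨hr0, -⟩ := hr
  intro m _ N hN
  have hhalf : 0 < r / 2 := by positivity
  have log_scale (k : ℕ) : Real.log ((r/2)^k * N) = k * Real.log (r/2) + Real.log N := by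
    rw [Real.log_mul (pow_pos hhalf k).ne' hN.ne', Real.log_pow]
  have log_gap (k : ℕ) : Real.log ((r/2)^k * (1 - r) * N) =
      (k + 2) * Real.log (r/2) + Real.log N := by
    rw [← hcrit, ← pow_add, log_scale]
    push_cast
    rfl
  simp only [log_scale, log_gap]
  clear * -
  induction m with
  | zero => simp
  | succ n ih =>
    rw [Finset.sum_Icc_succ_top (by omega), ← add_assoc, ← ih, Nat.add_sub_cancel]
    push_cast
    ring
end

section
/- For fixed K > 0, let r(m) ∈ (0,1) be the unique solution of (r/2)^2/(1-r) = exp(K/(2^m - 1)) for each positive integer m. Then r(m) > 2(√2 - 1) for all m, the sequence r(m) is strictly decreasing in m, and r(m) → 2(√2 - 1) as m → ∞. -/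
lemma strictMonoOn_sq_half_div_one_sub :
    StrictMonoOn (fun x : ℝ => (x / 2) ^ 2 / (1 - x)) (Set.Ioo 0 1) := by
  rintro x ⟨hx0, hx1⟩ y ⟨hy0, hy1⟩ hxy
  have hsq : (x / 2) ^ 2 < (y / 2) ^ 2 := by nlinarith
  exact div_lt_div₀ hsq (by linarith) (by positivity) (by linarith)

lemma two_mul_sqrt_two_sub_one_mem_Ioo : 2 * (Real.sqrt 2 - 1) ∈ Set.Ioo (0 : ℝ) 1 := by
  have h := Real.sq_sqrt (show (0 : ℝ) ≤ 2 by norm_num)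
  have h0 := Real.sqrt_nonneg 2
  constructor <;> nlinarith

lemma sq_half_two_mul_sqrt_two_sub_one :
    (2 * (Real.sqrt 2 - 1) / 2) ^ 2 = 1 - 2 * (Real.sqrt 2 - 1) := by
  have h := Real.sq_sqrt (show (0 : ℝ) ≤ 2 by norm_num)
  linear_combination h

lemma sub_le_sub_one_of_sq_half_div_eq {c x E : ℝ} (hc : 0 < c)
    (hceq : (c / 2) ^ 2 = 1 - c) (hx : x ∈ Set.Ioo (0 : ℝ) 1) (hcx : c < x) (hE : 1 ≤ E)
    (h : (x / 2) ^ 2 / (1 - x) = E) : x - c ≤ E - 1 := by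
  obtain ⟨hx0, hx1⟩ := hx
  rw [div_eq_iff (by linarith)] at h
  have key : (x - c) * ((x + c) / 4 + 1) = (E - 1) * (1 - x) := by
    linear_combination h - hceq
  nlinarith [mul_nonneg (sub_nonneg.2 hE) hx0.le,
    mul_pos (sub_pos.2 hcx) (add_pos hx0 hc)]

lemma tendsto_exp_div_two_pow_sub_one (K : ℝ) :
    Filter.Tendsto (fun m : ℕ => Real.exp (K / ((2 : ℝ) ^ m - 1))) Filter.atTop (nhds 1) := by
  have hpow : Filter.Tendsto (fun m : ℕ => (2 : ℝ) ^ m - 1) Filter.atTop Filter.atTop :=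
    Filter.tendsto_atTop_add_const_right _ (-1)
      (tendsto_pow_atTop_atTop_of_one_lt (by norm_num : (1 : ℝ) < 2))
  simpa [Function.comp_def] using (Real.continuous_exp.tendsto 0).comp (hpow.const_div_atTop K)

open Filter in
/-- For fixed `K > 0`, the solutions `r m` of `(r/2)^2/(1-r) = exp(K/(2^m - 1))`
satisfy `r m > 2(√2-1)`, are strictly decreasing in `m`, and tend to `2(√2-1)`. -/
theorem stmt3 (K : ℝ) (hK : 0 < K) (r : ℕ → ℝ)
    (hmem : ∀ m : ℕ, 0 < m → r m ∈ Set.Ioo (0:ℝ) 1)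
    (heq : ∀ m : ℕ, 0 < m →
      (r m / 2)^2 / (1 - r m) = Real.exp (K / ((2:ℝ)^m - 1))) :
    (∀ m : ℕ, 0 < m → 2 * (Real.sqrt 2 - 1) < r m) ∧
    (∀ m m' : ℕ, 0 < m → m < m' → r m' < r m) ∧
    Tendsto r atTop (nhds (2 * (Real.sqrt 2 - 1))) := by
  have hc := two_mul_sqrt_two_sub_one_mem_Ioo
  have hceq := sq_half_two_mul_sqrt_two_sub_one
  have hpow : ∀ m : ℕ, 0 < m → 0 < (2 : ℝ) ^ m - 1 := fun m hm =>
    sub_pos.2 (one_lt_pow₀ (by norm_num) hm.ne')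
  have hexp : ∀ m : ℕ, 0 < m → 1 < Real.exp (K / ((2 : ℝ) ^ m - 1)) := fun m hm =>
    Real.one_lt_exp_iff.2 (div_pos hK (hpow m hm))
  have hlt : ∀ m : ℕ, 0 < m → 2 * (Real.sqrt 2 - 1) < r m := by
    intro m hm
    refine (strictMonoOn_sq_half_div_one_sub.lt_iff_lt hc (hmem m hm)).1 ?_
    rw [heq m hm, hceq, div_self (sub_pos.2 hc.2).ne']
    exact hexp m hm
  refine ⟨hlt, fun m m' hm hmm' => ?_, ?_⟩
  · have hm' := hm.trans hmm'
    refine (strictMonoOn_sq_half_div_one_sub.lt_iff_lt (hmem m' hm') (hmem m hm)).1 ?_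
    rw [heq m hm, heq m' hm', Real.exp_lt_exp]
    exact div_lt_div_of_pos_left hK (hpow m hm)
      (sub_lt_sub_right (pow_lt_pow_right₀ (by norm_num) hmm') 1)
  · have hupper : Tendsto
        (fun m : ℕ => 2 * (Real.sqrt 2 - 1) + (Real.exp (K / ((2 : ℝ) ^ m - 1)) - 1))
        atTop (nhds (2 * (Real.sqrt 2 - 1))) := by
      simpa using ((tendsto_exp_div_two_pow_sub_one K).sub_const 1).const_add
        (2 * (Real.sqrt 2 - 1))
    refine tendsto_of_tendsto_of_tendsto_of_le_of_le' tendsto_const_nhds hupper ?_ ?_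
    · filter_upwards [eventually_gt_atTop 0] with m hm using (hlt m hm).le
    · filter_upwards [eventually_gt_atTop 0] with m hm
      linarith [sub_le_sub_one_of_sq_half_div_eq hc.1 hceq (hmem m hm) (hlt m hm)
        (hexp m hm).le (heq m hm)]
end

section
/- For every real x > 0 there exists a unique r ∈ (0,1) satisfying sinh^2(x r/2) = sinh(x) · sinh(x(1-r)). -/
/-- The difference of the two sides of the criticality condition is strictly increasing. -/
theorem strictMonoOn_sinh_sq_sub_sinh_mul_sinh {x : ℝ} (hx : 0 < x) :
    StrictMonoOn (fun r : ℝ ↦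
      (Real.sinh (x * r / 2))^2 - Real.sinh x * Real.sinh (x * (1 - r))) (Set.Ici 0) := by
  intro a ha b _ hab
  have ha' : (0:ℝ) ≤ a := ha
  have h_left : (Real.sinh (x * a / 2))^2 ≤ (Real.sinh (x * b / 2))^2 :=
    pow_le_pow_left₀ (Real.sinh_nonneg_iff.2 (by positivity))
      (Real.sinh_le_sinh.2 (by gcongr)) 2
  have h_right : Real.sinh x * Real.sinh (x * (1 - b)) < Real.sinh x * Real.sinh (x * (1 - a)) :=
    mul_lt_mul_of_pos_left (Real.sinh_lt_sinh.2 (by gcongr)) (Real.sinh_pos_iff.2 hx)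
  dsimp only
  linarith

/-- For every `x > 0` there is a unique `r ∈ (0,1)` with
`sinh(x r/2)^2 = sinh x · sinh(x(1-r))`. -/
theorem stmt5 (x : ℝ) (hx : 0 < x) :
    ∃! r : ℝ, r ∈ Set.Ioo (0:ℝ) 1 ∧
      (Real.sinh (x * r / 2))^2 = Real.sinh x * Real.sinh (x * (1 - r)) := by
  have h_cont : ContinuousOn (fun r : ℝ ↦
      (Real.sinh (x * r / 2))^2 - Real.sinh x * Real.sinh (x * (1 - r))) (Set.Icc 0 1) := by
    fun_prop
  have h_sinh : 0 < Real.sinh x := Real.sinh_pos_iff.2 hx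
  have h_half : 0 < Real.sinh (x / 2) := Real.sinh_pos_iff.2 (by positivity)
  obtain ⟨r, hr, h_zero⟩ := intermediate_value_Ioo zero_le_one h_cont
    (show (0:ℝ) ∈ Set.Ioo _ _ by constructor <;> simp <;> positivity)
  refine ⟨r, ⟨hr, sub_eq_zero.1 h_zero⟩, fun s ⟨hs, h_eq⟩ ↦ ?_⟩
  exact (strictMonoOn_sinh_sq_sub_sinh_mul_sinh hx).injOn hs.1.le hr.1.le
    ((sub_eq_zero.2 h_eq).trans h_zero.symm)
end

section
/- For each x > 0 let r(x) ∈ (0,1) be the unique solution of sinh^2(x r/2) = sinh(x) · sinh(x(1-r)). Then r(x) → 2(√2 - 1) as x → 0⁺. -/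
theorem sinh_le_self_mul_cosh {x y : ℝ} (hy : 0 < y) (hyx : y ≤ x) :
    Real.sinh y ≤ y * Real.cosh x := by
  obtain ⟨c, hc, h⟩ := exists_hasDerivAt_eq_slope Real.sinh Real.cosh hy
    Real.continuous_sinh.continuousOn (fun z _ => Real.hasDerivAt_sinh z)
  rw [Real.sinh_zero, sub_zero, sub_zero, eq_div_iff hy.ne'] at h
  have hcosh : Real.cosh c ≤ Real.cosh x := by
    rw [Real.cosh_le_cosh, abs_of_pos hc.1, abs_of_pos (hy.trans_le hyx)]
    exact hc.2.le.trans hyx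
  nlinarith

/-- A solution of the criticality equation is within `4 sinh² x` of `2(√2 - 1)`. -/
theorem abs_sub_le_of_sinh_sq_eq {x r : ℝ} (hx : 0 < x) (hr : r ∈ Set.Ioo (0 : ℝ) 1)
    (h : (Real.sinh (x * r / 2)) ^ 2 = Real.sinh x * Real.sinh (x * (1 - r))) :
    |r - 2 * (Real.sqrt 2 - 1)| ≤ 4 * Real.sinh x ^ 2 := by
  obtain ⟨h0, h1⟩ := hr
  have hr' : 0 < 1 - r := sub_pos.2 h1
  have hx2 : 0 < x ^ 2 := by positivity
  have hu : 0 < x * r / 2 := by positivity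
  have hv : 0 < x * (1 - r) := by positivity
  have hux : x * r / 2 ≤ x := by nlinarith
  have hvx : x * (1 - r) ≤ x := by nlinarith
  have lu := Real.self_le_sinh_iff.2 hu.le
  have lv := Real.self_le_sinh_iff.2 hv.le
  have lx := Real.self_le_sinh_iff.2 hx.le
  have lower : r ^ 2 / 4 ≤ (1 - r) * Real.cosh x ^ 2 := by
    refine le_of_mul_le_mul_left ?_ hx2
    calc x ^ 2 * (r ^ 2 / 4) = (x * r / 2) ^ 2 := by ring
      _ ≤ Real.sinh (x * r / 2) ^ 2 := by gcongr
      _ = Real.sinh x * Real.sinh (x * (1 - r)) := h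
      _ ≤ (x * Real.cosh x) * (x * (1 - r) * Real.cosh x) :=
        mul_le_mul (sinh_le_self_mul_cosh hx le_rfl) (sinh_le_self_mul_cosh hv hvx)
          (hv.le.trans lv) (by positivity)
      _ = x ^ 2 * ((1 - r) * Real.cosh x ^ 2) := by ring
  have upper : 1 - r ≤ r ^ 2 / 4 * Real.cosh x ^ 2 := by
    refine le_of_mul_le_mul_left ?_ hx2
    calc x ^ 2 * (1 - r) = x * (x * (1 - r)) := by ring
      _ ≤ Real.sinh x * Real.sinh (x * (1 - r)) :=
        mul_le_mul lx lv hv.le (hx.le.trans lx)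
      _ = Real.sinh (x * r / 2) ^ 2 := h.symm
      _ ≤ (x * r / 2 * Real.cosh x) ^ 2 :=
        pow_le_pow_left₀ (hu.le.trans lu) (sinh_le_self_mul_cosh hu hux) 2
      _ = x ^ 2 * (r ^ 2 / 4 * Real.cosh x ^ 2) := by ring
  rw [Real.cosh_sq] at lower upper
  have hs : 0 ≤ Real.sinh x ^ 2 := sq_nonneg _
  have quad : |r ^ 2 + 4 * r - 4| ≤ 4 * Real.sinh x ^ 2 := by
    rw [abs_le]
    constructor <;> nlinarith
  have factor : r ^ 2 + 4 * r - 4 = (r - 2 * (Real.sqrt 2 - 1)) * (r + 2 + 2 * Real.sqrt 2) := by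
    linear_combination 4 * Real.sq_sqrt (show (0 : ℝ) ≤ 2 by norm_num)
  have hs2 := Real.sqrt_nonneg 2
  refine le_trans ?_ quad
  rw [factor, abs_mul]
  refine le_mul_of_one_le_right (abs_nonneg _) ?_
  rw [abs_of_nonneg (by positivity)]
  linarith

open Filter in
/-- If for each `x > 0`, `r x ∈ (0,1)` solves `sinh(x r/2)^2 = sinh x · sinh(x(1-r))`,
then `r x → 2(√2 - 1)` as `x → 0⁺`. -/
theorem stmt6 (r : ℝ → ℝ)
    (hmem : ∀ x : ℝ, 0 < x → r x ∈ Set.Ioo (0:ℝ) 1)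
    (heq : ∀ x : ℝ, 0 < x →
      (Real.sinh (x * r x / 2))^2 = Real.sinh x * Real.sinh (x * (1 - r x))) :
    Tendsto r (nhdsWithin 0 (Set.Ioi 0)) (nhds (2 * (Real.sqrt 2 - 1))) := by
  have hlim : Tendsto (fun x : ℝ => 4 * Real.sinh x ^ 2) (nhdsWithin 0 (Set.Ioi 0)) (nhds 0) := by
    have hcont : Continuous fun x : ℝ => 4 * Real.sinh x ^ 2 := by fun_prop
    simpa using (hcont.tendsto 0).mono_left nhdsWithin_le_nhds
  rw [tendsto_iff_dist_tendsto_zero]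
  refine squeeze_zero' (Eventually.of_forall fun _ => dist_nonneg) ?_ hlim
  filter_upwards [self_mem_nhdsWithin] with x hx
  exact abs_sub_le_of_sinh_sq_eq hx (hmem x hx) (heq x hx)
end

section
/- Let x > 0 satisfy 8 cosh^2(x) ≠ 9, and define r = (2/x) · arcsinh( √( ((2√2 cosh x - 3) sinh^2 x) / (4 cosh 2x - 5) ) ). Then the quantity under the square root is nonnegative and r satisfies sinh^2(x r/2) = sinh(x) · sinh(x(1-r)). -/
/-- Explicit solution of the level-1 BTZ criticality equation. -/
theorem stmt7 (x : ℝ) (hx : 0 < x) (hne : 8 * (Real.cosh x)^2 ≠ 9) :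
    0 ≤ (2 * Real.sqrt 2 * Real.cosh x - 3) * (Real.sinh x)^2 /
        (4 * Real.cosh (2*x) - 5) ∧
    (Real.sinh (x * ((2/x) * Real.arsinh (Real.sqrt
        ((2 * Real.sqrt 2 * Real.cosh x - 3) * (Real.sinh x)^2 /
          (4 * Real.cosh (2*x) - 5)))) / 2))^2 =
      Real.sinh x * Real.sinh (x * (1 - (2/x) * Real.arsinh (Real.sqrt
        ((2 * Real.sqrt 2 * Real.cosh x - 3) * (Real.sinh x)^2 /
          (4 * Real.cosh (2*x) - 5))))) := by
  have hS : 0 < Real.sinh x := Real.sinh_pos_iff.2 hx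
  have hC : 0 < Real.cosh x := Real.cosh_pos x
  have hs : Real.sqrt 2 ^ 2 = 2 := Real.sq_sqrt (by norm_num)
  have hs0 : 0 < Real.sqrt 2 := by positivity
  have hCS : Real.cosh x ^ 2 = Real.sinh x ^ 2 + 1 := Real.cosh_sq x
  have hD : 0 < 2 * Real.sqrt 2 * Real.cosh x + 3 := by positivity
  have hfac : 4 * Real.cosh (2 * x) - 5 =
      (2 * Real.sqrt 2 * Real.cosh x - 3) * (2 * Real.sqrt 2 * Real.cosh x + 3) := by
    rw [Real.cosh_two_mul]
    linear_combination (-4 * Real.cosh x ^ 2) * hs - 4 * hCS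
  have hm : 2 * Real.sqrt 2 * Real.cosh x - 3 ≠ 0 := fun h => hne (by
    linear_combination (2 * Real.sqrt 2 * Real.cosh x + 3) * h - 4 * Real.cosh x ^ 2 * hs)
  rw [hfac, mul_div_mul_left _ _ hm]
  refine ⟨by positivity, ?_⟩
  generalize hA : Real.arsinh (Real.sqrt
    (Real.sinh x ^ 2 / (2 * Real.sqrt 2 * Real.cosh x + 3))) = A
  set d := Real.sqrt (2 * Real.sqrt 2 * Real.cosh x + 3) with hd
  have hd2 : d ^ 2 = 2 * Real.sqrt 2 * Real.cosh x + 3 := Real.sq_sqrt hD.le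
  have hd0 : 0 < d := Real.sqrt_pos.2 hD
  have hsA : Real.sinh A = Real.sinh x / d := by
    rw [← hA, Real.sinh_arsinh, Real.sqrt_div (sq_nonneg _), Real.sqrt_sq hS.le]
  have hcA : Real.cosh A = (Real.cosh x + Real.sqrt 2) / d := by
    rw [← sq_eq_sq₀ (Real.cosh_pos A).le (by positivity), Real.cosh_sq, hsA]
    field_simp
    linear_combination hd2 - hCS - hs
  have h1 : x * (2 / x * A) / 2 = A := by field_simp
  have h2 : x * (1 - 2 / x * A) = x - 2 * A := by field_simp
  rw [h1, h2, Real.sinh_sub, Real.sinh_two_mul, Real.cosh_two_mul, hsA, hcA]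
  field_simp
  linear_combination hCS - hs
end

section
/- For all reals x₊ > 0 and x₋ > 0 there exists a unique r ∈ (0,1) satisfying sinh^2(x₋ r/2) · sinh^2(x₊ r/2) = sinh(x₋) · sinh(x₊) · sinh(x₋(1-r)) · sinh(x₊(1-r)). -/
theorem strictMonoOn_sq_sinh_mul_sq_sinh {a b : ℝ} (ha : 0 < a) (hb : 0 < b) :
    StrictMonoOn (fun r : ℝ => (Real.sinh (a * r / 2)) ^ 2 * (Real.sinh (b * r / 2)) ^ 2)
      (Set.Icc 0 1) := by
  have key : ∀ {c : ℝ}, 0 < c → ∀ {r s : ℝ}, 0 ≤ r → r < s →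
      Real.sinh (c * r / 2) ^ 2 < Real.sinh (c * s / 2) ^ 2 := by
    intro c hc r s hr hrs
    have hnonneg : 0 ≤ Real.sinh (c * r / 2) := Real.sinh_nonneg_iff.2 (by positivity)
    have hlt : Real.sinh (c * r / 2) < Real.sinh (c * s / 2) :=
      Real.sinh_lt_sinh.2 (by gcongr)
    gcongr
  intro r hr s _ hrs
  exact mul_lt_mul'' (key ha hr.1 hrs) (key hb hr.1 hrs) (sq_nonneg _) (sq_nonneg _)

theorem strictAntiOn_sinh_mul_sinh {a b : ℝ} (ha : 0 < a) (hb : 0 < b) :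
    StrictAntiOn (fun r : ℝ => Real.sinh b * Real.sinh a *
      Real.sinh (b * (1 - r)) * Real.sinh (a * (1 - r))) (Set.Icc 0 1) := by
  have hnonneg : ∀ {c : ℝ}, 0 < c → ∀ {s : ℝ}, s ≤ 1 → 0 ≤ Real.sinh (c * (1 - s)) :=
    fun hc _ hs => Real.sinh_nonneg_iff.2 (mul_nonneg hc.le (sub_nonneg.2 hs))
  have hlt : ∀ {c : ℝ}, 0 < c → ∀ {r s : ℝ}, r < s →
      Real.sinh (c * (1 - s)) < Real.sinh (c * (1 - r)) :=
    fun hc _ _ hrs => Real.sinh_lt_sinh.2 (by gcongr)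
  have hpos : 0 < Real.sinh b * Real.sinh a :=
    mul_pos (Real.sinh_pos_iff.2 hb) (Real.sinh_pos_iff.2 ha)
  intro r _ s hs hrs
  exact mul_lt_mul'' (mul_lt_mul_of_pos_left (hlt hb hrs) hpos) (hlt ha hrs)
    (mul_nonneg hpos.le (hnonneg hb hs.2)) (hnonneg ha hs.2)

/-- Rotating BTZ level-1 criticality: unique solution `r ∈ (0,1)`. -/
theorem stmt8 (xp xm : ℝ) (hxp : 0 < xp) (hxm : 0 < xm) :
    ∃! r : ℝ, r ∈ Set.Ioo (0:ℝ) 1 ∧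
      (Real.sinh (xm * r / 2))^2 * (Real.sinh (xp * r / 2))^2 =
        Real.sinh xm * Real.sinh xp *
          Real.sinh (xm * (1 - r)) * Real.sinh (xp * (1 - r)) := by
  let f : ℝ → ℝ := fun r =>
    (Real.sinh (xm * r / 2)) ^ 2 * (Real.sinh (xp * r / 2)) ^ 2 -
      Real.sinh xm * Real.sinh xp * Real.sinh (xm * (1 - r)) * Real.sinh (xp * (1 - r))
  have hmono : StrictMonoOn f (Set.Icc 0 1) := fun r hr s hs hrs =>
    sub_lt_sub (strictMonoOn_sq_sinh_mul_sq_sinh hxm hxp hr hs hrs)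
      (strictAntiOn_sinh_mul_sinh hxp hxm hr hs hrs)
  have hcont : Continuous f := by
    have := Real.continuous_sinh
    fun_prop
  have hp : 0 < Real.sinh xp := Real.sinh_pos_iff.2 hxp
  have hm : 0 < Real.sinh xm := Real.sinh_pos_iff.2 hxm
  have hf0 : f 0 < 0 := by
    simp only [f, mul_zero, zero_div, Real.sinh_zero, sub_zero, mul_one, ne_eq,
      OfNat.ofNat_ne_zero, not_false_eq_true, zero_pow, zero_sub, neg_lt_zero]
    positivity
  have hf1 : 0 < f 1 := by
    have hp2 : 0 < Real.sinh (xp / 2) := Real.sinh_pos_iff.2 (half_pos hxp)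
    have hm2 : 0 < Real.sinh (xm / 2) := Real.sinh_pos_iff.2 (half_pos hxm)
    simp only [f, mul_one, sub_self, mul_zero, Real.sinh_zero, sub_zero]
    positivity
  obtain ⟨r, hr, hfr⟩ :=
    intermediate_value_Ioo zero_le_one hcont.continuousOn (show (0 : ℝ) ∈ _ from ⟨hf0, hf1⟩)
  refine ⟨r, ⟨hr, sub_eq_zero.1 hfr⟩, ?_⟩
  rintro s ⟨hs, hfs⟩
  exact hmono.injOn (Set.Ioo_subset_Icc_self hs) (Set.Ioo_subset_Icc_self hr)
    ((sub_eq_zero.2 hfs).trans hfr.symm)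
end

section
/- Fix A, B, L, l, ε > 0 and set D = 2Al²/(BL). For r ∈ (0,1), the equality A r l/ε - 4BL/(r l) = A l/ε - BL/l + A(1-r) l/ε - BL/((1-r) l) holds if and only if D · r · (1-r)² = ε · (6r - 4 - r²). Moreover every solution r ∈ (0,1) satisfies r ≥ 3 - √5 and (1-r)² ≤ ε/(D(3-√5)); in particular, as ε → 0⁺ with D fixed, every solution tends to 1. -/
/-- The criticality equality is equivalent to a polynomial equation in `r`. -/
theorem strip_criticality_iff {A B L l ε r : ℝ} (hB : 0 < B) (hL : 0 < L) (hl : 0 < l)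
    (hε : 0 < ε) (hr : r ∈ Set.Ioo (0 : ℝ) 1) :
    A * r * l / ε - 4 * B * L / (r * l) =
        A * l / ε - B * L / l + A * (1 - r) * l / ε - B * L / ((1 - r) * l)
      ↔ 2 * A * l^2 / (B * L) * r * (1 - r)^2 = ε * (6 * r - 4 - r^2) := by
  have hr0 : r ≠ 0 := hr.1.ne'
  have hr1 : 1 - r ≠ 0 := (sub_pos.2 hr.2).ne'
  have key : A * r * l / ε - 4 * B * L / (r * l) -
      (A * l / ε - B * L / l + A * (1 - r) * l / ε - B * L / ((1 - r) * l)) =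
      B * L / (l * r * (1 - r) * ε) *
        (ε * (6 * r - 4 - r^2) - 2 * A * l^2 / (B * L) * r * (1 - r)^2) := by
    field_simp
    ring
  have hc : B * L / (l * r * (1 - r) * ε) ≠ 0 := by positivity
  rw [← sub_eq_zero, key, mul_eq_zero, or_iff_right hc, sub_eq_zero, eq_comm]

theorem three_sub_sqrt_five_pos : 0 < 3 - √(5 : ℝ) :=
  sub_pos.2 ((Real.sqrt_lt' (by norm_num)).2 (by norm_num))

/-- Lower bound on the solutions of the polynomial criticality equation in `(0, 1)`. -/
theorem three_sub_sqrt_five_le_of_criticality {D ε r : ℝ} (hD : 0 < D) (hε : 0 < ε)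
    (hr : r ∈ Set.Ioo (0 : ℝ) 1) (h : D * r * (1 - r)^2 = ε * (6 * r - 4 - r^2)) :
    3 - √5 ≤ r := by
  have hr0 := hr.1
  have hq : 0 ≤ 6 * r - 4 - r^2 := nonneg_of_mul_nonneg_right (h ▸ by positivity) hε
  have : 3 - r ≤ √5 := Real.le_sqrt_of_sq_le (by linarith)
  linarith

/-- Solutions of the polynomial criticality equation in `(0, 1)` are close to `1`. -/
theorem one_sub_sq_le_of_criticality {D ε r : ℝ} (hD : 0 < D) (hε : 0 < ε)
    (hr : r ∈ Set.Ioo (0 : ℝ) 1) (h : D * r * (1 - r)^2 = ε * (6 * r - 4 - r^2)) :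
    (1 - r)^2 ≤ ε / (D * (3 - √5)) := by
  rw [le_div_iff₀ (mul_pos hD three_sub_sqrt_five_pos)]
  calc (1 - r)^2 * (D * (3 - √5)) ≤ (1 - r)^2 * (D * r) := by
        gcongr
        exact three_sub_sqrt_five_le_of_criticality hD hε hr h
    _ = ε * (6 * r - 4 - r^2) := by rw [← h]; ring
    _ ≤ ε := mul_le_of_le_one_right hε.le (by nlinarith [hr.1, hr.2])

/-- Annulus-stretched strip, level-1 criticality: equivalence to
`D r (1-r)^2 = ε (6r - 4 - r^2)`, lower bound `r ≥ 3 - √5`, the bound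
`(1-r)^2 ≤ ε/(D(3-√5))`, and `r → 1` as `ε → 0⁺` with `D` fixed. -/
theorem stmt10 (A B L l : ℝ) (hA : 0 < A) (hB : 0 < B) (hL : 0 < L) (hl : 0 < l)
    (D : ℝ) (hD : D = 2 * A * l^2 / (B * L)) :
    (∀ ε : ℝ, 0 < ε → ∀ r ∈ Set.Ioo (0:ℝ) 1,
      (A * r * l / ε - 4 * B * L / (r * l) =
          A * l / ε - B * L / l + A * (1 - r) * l / ε - B * L / ((1 - r) * l)
        ↔ D * r * (1 - r)^2 = ε * (6 * r - 4 - r^2))) ∧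
    (∀ ε : ℝ, 0 < ε → ∀ r ∈ Set.Ioo (0:ℝ) 1,
      A * r * l / ε - 4 * B * L / (r * l) =
          A * l / ε - B * L / l + A * (1 - r) * l / ε - B * L / ((1 - r) * l) →
        3 - Real.sqrt 5 ≤ r ∧ (1 - r)^2 ≤ ε / (D * (3 - Real.sqrt 5))) ∧
    (∀ δ : ℝ, 0 < δ → ∃ ε₀ : ℝ, 0 < ε₀ ∧ ∀ ε : ℝ, 0 < ε → ε < ε₀ →
      ∀ r ∈ Set.Ioo (0:ℝ) 1,
        A * r * l / ε - 4 * B * L / (r * l) =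
            A * l / ε - B * L / l + A * (1 - r) * l / ε - B * L / ((1 - r) * l) →
          |r - 1| < δ) := by
  have hDpos : 0 < D := by rw [hD]; positivity
  have hiff : ∀ ε : ℝ, 0 < ε → ∀ r ∈ Set.Ioo (0:ℝ) 1,
      (A * r * l / ε - 4 * B * L / (r * l) =
          A * l / ε - B * L / l + A * (1 - r) * l / ε - B * L / ((1 - r) * l)
        ↔ D * r * (1 - r)^2 = ε * (6 * r - 4 - r^2)) := fun ε hε r hr => by
    rw [hD]
    exact strip_criticality_iff hB hL hl hε hr
  refine ⟨hiff, fun ε hε r hr h => ?_, fun δ hδ => ?_⟩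
  · have h' := (hiff ε hε r hr).1 h
    exact ⟨three_sub_sqrt_five_le_of_criticality hDpos hε hr h',
      one_sub_sq_le_of_criticality hDpos hε hr h'⟩
  · have hc : 0 < D * (3 - √5) := mul_pos hDpos three_sub_sqrt_five_pos
    refine ⟨δ^2 * (D * (3 - √5)), by positivity, fun ε hε hεδ r hr h => ?_⟩
    have hsq : (1 - r)^2 < δ^2 :=
      (one_sub_sq_le_of_criticality hDpos hε hr ((hiff ε hε r hr).1 h)).trans_lt
        ((div_lt_iff₀ hc).2 hεδ)
    rw [abs_sub_comm]
    exact abs_lt_of_sq_lt_sq hsq hδ.le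
end

section
/- For every integer d ≥ 3 there is exactly one r ∈ (0,1) satisfying 2^{d-1} r^{2-d} - (1-r)^{2-d} = 1; moreover the function r ↦ 2^{d-1} r^{2-d} - (1-r)^{2-d} is strictly decreasing on (0,1), tends to +∞ as r → 0⁺ and to -∞ as r → 1⁻, and the unique solution satisfies r > 2/3. -/
section CantorCriticality

variable {c s : ℝ}

theorem strictAntiOn_mul_rpow_sub_one_sub_rpow (hc : 0 < c) (hs : s < 0) :
    StrictAntiOn (fun r : ℝ => c * r ^ s - (1 - r) ^ s) (Set.Ioo 0 1) := by
  intro x hx y hy hxy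
  have h₁ : y ^ s < x ^ s := Real.rpow_lt_rpow_of_neg hx.1 hxy hs
  have h₂ : (1 - x) ^ s < (1 - y) ^ s :=
    Real.rpow_lt_rpow_of_neg (by linarith [hy.2]) (by linarith) hs
  have h₃ : c * y ^ s < c * x ^ s := mul_lt_mul_of_pos_left h₁ hc
  simp only
  linarith

theorem tendsto_mul_rpow_sub_one_sub_rpow_nhdsGT_zero (hc : 0 < c) (hs : s < 0) :
    Filter.Tendsto (fun r : ℝ => c * r ^ s - (1 - r) ^ s)
      (nhdsWithin 0 (Set.Ioi 0)) Filter.atTop := by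
  have h₁ := (tendsto_rpow_neg_nhdsGT_zero hs).const_mul_atTop hc
  have h₂ : ContinuousAt (fun r : ℝ => -(1 - r) ^ s) 0 :=
    ((continuousAt_const.sub continuousAt_id).rpow_const (Or.inl (by simp))).neg
  simpa only [sub_eq_add_neg] using
    h₁.atTop_add (h₂.tendsto.mono_left nhdsWithin_le_nhds)

theorem tendsto_mul_rpow_sub_one_sub_rpow_nhdsLT_one (hs : s < 0) :
    Filter.Tendsto (fun r : ℝ => c * r ^ s - (1 - r) ^ s)
      (nhdsWithin 1 (Set.Iio 1)) Filter.atBot := by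
  have h₀ : Filter.Tendsto (fun r : ℝ => 1 - r) (nhdsWithin 1 (Set.Iio 1))
      (nhdsWithin 0 (Set.Ioi 0)) := by
    refine tendsto_nhdsWithin_iff.2 ⟨?_, ?_⟩
    · have : Filter.Tendsto (fun r : ℝ => 1 - r) (nhds 1) (nhds (1 - 1)) :=
        tendsto_const_nhds.sub Filter.tendsto_id
      rw [sub_self] at this
      exact this.mono_left nhdsWithin_le_nhds
    · filter_upwards [self_mem_nhdsWithin] with r hr
      exact sub_pos.2 (Set.mem_Iio.1 hr)
  have h₁ := Filter.tendsto_neg_atTop_atBot.comp ((tendsto_rpow_neg_nhdsGT_zero hs).comp h₀)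
  have h₂ : ContinuousAt (fun r : ℝ => c * r ^ s) 1 :=
    continuousAt_const.mul (continuousAt_id.rpow_const (Or.inl one_ne_zero))
  simpa only [sub_eq_add_neg, Function.comp_def] using
    (h₂.tendsto.mono_left nhdsWithin_le_nhds).add_atBot h₁

theorem continuousOn_mul_rpow_sub_one_sub_rpow :
    ContinuousOn (fun r : ℝ => c * r ^ s - (1 - r) ^ s) (Set.Ioo 0 1) :=
  (continuousOn_const.mul (continuousOn_id.rpow_const fun _ hx => Or.inl hx.1.ne')).sub
    ((continuousOn_const.sub continuousOn_id).rpow_const fun _ hx =>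
      Or.inl (sub_pos.2 hx.2).ne')

theorem one_lt_criticality_two_thirds {d : ℕ} (hd : 3 ≤ d) :
    1 < (2:ℝ) ^ (d - 1) * (2 / 3 : ℝ) ^ ((2:ℝ) - d) - (1 - 2 / 3 : ℝ) ^ ((2:ℝ) - d) := by
  obtain ⟨n, rfl⟩ := Nat.exists_eq_add_of_le' hd
  have he : (2:ℝ) - ((n + 3 : ℕ) : ℝ) = -((n + 1 : ℕ) : ℝ) := by push_cast; ring
  have hn : n + 3 - 1 = n + 1 + 1 := rfl
  have h₃ : (1:ℝ) < 3 ^ (n + 1) := one_lt_pow₀ (by norm_num) n.succ_ne_zero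
  have h : (2:ℝ) ^ (n + 1 + 1) * ((2 / 3 : ℝ) ^ (n + 1))⁻¹ = 2 * 3 ^ (n + 1) := by
    rw [div_pow, inv_div, pow_succ 2 (n + 1)]
    field_simp
  have h' : ((1 - 2 / 3 : ℝ) ^ (n + 1))⁻¹ = 3 ^ (n + 1) := by
    rw [← inv_pow]; norm_num
  rw [he, hn, Real.rpow_neg (by norm_num), Real.rpow_neg (by norm_num), Real.rpow_natCast,
    Real.rpow_natCast, h, h']
  linarith

end CantorCriticality

open Filter in
/-- For every integer `d ≥ 3` the function `r ↦ 2^(d-1) r^(2-d) - (1-r)^(2-d)`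
is strictly decreasing on `(0,1)`, tends to `+∞` as `r → 0⁺` and to `-∞` as
`r → 1⁻`, takes the value `1` at exactly one `r ∈ (0,1)`, and that solution
satisfies `r > 2/3`. -/
theorem stmt11 (d : ℕ) (hd : 3 ≤ d) :
    StrictAntiOn
      (fun r : ℝ => (2:ℝ)^(d-1) * r ^ ((2:ℝ) - d) - (1 - r) ^ ((2:ℝ) - d))
      (Set.Ioo 0 1) ∧
    Tendsto (fun r : ℝ => (2:ℝ)^(d-1) * r ^ ((2:ℝ) - d) - (1 - r) ^ ((2:ℝ) - d))
      (nhdsWithin 0 (Set.Ioi 0)) atTop ∧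
    Tendsto (fun r : ℝ => (2:ℝ)^(d-1) * r ^ ((2:ℝ) - d) - (1 - r) ^ ((2:ℝ) - d))
      (nhdsWithin 1 (Set.Iio 1)) atBot ∧
    (∃! r : ℝ, r ∈ Set.Ioo (0:ℝ) 1 ∧
      (2:ℝ)^(d-1) * r ^ ((2:ℝ) - d) - (1 - r) ^ ((2:ℝ) - d) = 1) ∧
    (∀ r ∈ Set.Ioo (0:ℝ) 1,
      (2:ℝ)^(d-1) * r ^ ((2:ℝ) - d) - (1 - r) ^ ((2:ℝ) - d) = 1 → 2/3 < r) := by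
  have hs : (2:ℝ) - d < 0 := by
    have : (3:ℝ) ≤ d := by exact_mod_cast hd
    linarith
  have hc : (0:ℝ) < 2 ^ (d - 1) := by positivity
  have hanti := strictAntiOn_mul_rpow_sub_one_sub_rpow hc hs
  have hbot := tendsto_mul_rpow_sub_one_sub_rpow_nhdsLT_one (c := (2:ℝ) ^ (d - 1)) hs
  have hmem : (2 / 3 : ℝ) ∈ Set.Ioo (0:ℝ) 1 := by norm_num
  have hval := one_lt_criticality_two_thirds hd
  refine ⟨hanti, tendsto_mul_rpow_sub_one_sub_rpow_nhdsGT_zero hc hs, hbot, ?_, ?_⟩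
  · obtain ⟨b, hb, hb₁, hb₂⟩ := ((hbot.eventually_le_atBot 1).and
      (Ioo_mem_nhdsLT hmem.2)).exists
    obtain ⟨r, hr, hr₁⟩ := intermediate_value_Icc' hb₁.le
      (continuousOn_mul_rpow_sub_one_sub_rpow.mono
        (Set.Icc_subset_Ioo hmem.1 hb₂)) ⟨hb, hval.le⟩
    have hr₀ := Set.Icc_subset_Ioo hmem.1 hb₂ hr
    exact ⟨r, ⟨hr₀, hr₁⟩, fun y hy => hanti.injOn hy.1 hr₀ (hy.2.trans hr₁.symm)⟩
  · intro r hr h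
    exact (hanti.lt_iff_gt hr hmem).1 (by simpa only [h] using hval)
end

section
/- For each integer d ≥ 3, let r_d ∈ (0,1) be the unique solution of 2^{d-1} r^{2-d} - (1-r)^{2-d} = 1. Then r_d → 2/3 as d → ∞. -/
/-- A solution `x ∈ (0,1)` of `2^(n+1) x^(-n) - (1-x)^(-n) = 1` lies within `1/n` above `2/3`. -/
theorem mem_Icc_of_two_pow_mul_inv_sub_inv_eq_one {x : ℝ} {n : ℕ} (hn : n ≠ 0)
    (hx : x ∈ Set.Ioo (0 : ℝ) 1)
    (h : (2 : ℝ) ^ (n + 1) * (x ^ n)⁻¹ - ((1 - x) ^ n)⁻¹ = 1) :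
    x ∈ Set.Icc (2 / 3 : ℝ) (2 / 3 + 1 / n) := by
  obtain ⟨hx0, hx1⟩ := hx
  have hy0 : 0 < 1 - x := by linarith
  have hxn : 0 < x ^ n := by positivity
  have hyn : 0 < (1 - x) ^ n := by positivity
  have hn0 : (0 : ℝ) < n := by positivity
  have key : 2 * (2 * (1 - x)) ^ n - x ^ n = x ^ n * (1 - x) ^ n := by
    rw [mul_pow]
    field_simp at h
    rw [pow_succ] at h
    linarith
  have hlt : (1 - x) ^ n < 1 := pow_lt_one₀ hy0.le (by linarith) hn
  have hlower : 2 * (1 - x) < x := by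
    refine lt_of_pow_lt_pow_left₀ n hx0.le ?_
    nlinarith
  have hupper : (x / (2 * (1 - x))) ^ n < 2 := by
    rw [div_pow, div_lt_iff₀ (by positivity)]
    nlinarith [mul_pos hxn hyn]
  have hbern := one_add_mul_le_pow (a := x / (2 * (1 - x)) - 1)
    (by have : 0 < x / (2 * (1 - x)) := by positivity
        linarith) n
  rw [add_sub_cancel] at hbern
  have hratio : x / (2 * (1 - x)) - 1 < 1 / n := by
    rw [lt_div_iff₀ hn0]
    linarith
  have hbound : x < (1 + 1 / n) * (2 * (1 - x)) := by
    rw [← div_lt_iff₀ (by positivity)]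
    linarith
  have hinv : (0 : ℝ) < 1 / n := by positivity
  constructor
  · linarith
  · nlinarith

open Filter in
/-- If `r d ∈ (0,1)` solves `2^(d-1) (r d)^(2-d) - (1 - r d)^(2-d) = 1` for each
integer `d ≥ 3`, then `r d → 2/3` as `d → ∞`. -/
theorem stmt14 (r : ℕ → ℝ)
    (hmem : ∀ d : ℕ, 3 ≤ d → r d ∈ Set.Ioo (0:ℝ) 1)
    (heq : ∀ d : ℕ, 3 ≤ d →
      (2:ℝ)^(d-1) * (r d) ^ ((2:ℝ) - d) - (1 - r d) ^ ((2:ℝ) - d) = 1) :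
    Tendsto r atTop (nhds (2/3)) := by
  rw [← tendsto_add_atTop_iff_nat 2]
  have hbounds : ∀ᶠ n : ℕ in atTop, r (n + 2) ∈ Set.Icc (2 / 3 : ℝ) (2 / 3 + 1 / n) := by
    filter_upwards [eventually_ge_atTop 1] with n hn
    have hr := hmem (n + 2) (by lia)
    refine mem_Icc_of_two_pow_mul_inv_sub_inv_eq_one (by lia) hr ?_
    have h := heq (n + 2) (by lia)
    have hexp : (2 : ℝ) - ((n + 2 : ℕ) : ℝ) = -(n : ℝ) := by
      push_cast
      ring
    rwa [hexp, Real.rpow_neg hr.1.le, Real.rpow_neg (sub_nonneg.2 hr.2.le),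
      Real.rpow_natCast, Real.rpow_natCast] at h
  have hlim : Tendsto (fun n : ℕ => (2 / 3 : ℝ) + 1 / n) atTop (nhds (2 / 3)) := by
    simpa using tendsto_one_div_atTop_nhds_zero_nat.const_add (2 / 3 : ℝ)
  exact tendsto_of_tendsto_of_tendsto_of_le_of_le' tendsto_const_nhds hlim
    (hbounds.mono fun _ h => h.1) (hbounds.mono fun _ h => h.2)
end

section
/- Let d ≥ 3 be an integer and let r ∈ (0,1) satisfy the level-1 equation 2 · (2/r)^{d-2} = 1 + (1-r)^{2-d}. Then for every positive integer m the level-m equation holds: 2^m · (2/r)^{m(d-2)} = 1 + (1-r)^{2-d} · Σ_{j=1}^m 2^{j-1} · (2/r)^{(d-2)(j-1)}. In particular the critical ratio r is independent of the level m. -/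
/-- If `r ∈ (0,1)` satisfies the level-1 strip equation
`2 (2/r)^(d-2) = 1 + (1-r)^(2-d)` then it satisfies the level-`m` equation for
every positive integer `m`: the critical ratio is independent of the level. -/
theorem stmt15 (d : ℕ) (hd : 3 ≤ d) (r : ℝ) (hr : r ∈ Set.Ioo (0:ℝ) 1)
    (h1 : 2 * (2/r)^(d-2) = 1 + (1 - r) ^ ((2:ℝ) - d)) :
    ∀ m : ℕ, 0 < m →
      (2:ℝ)^m * (2/r)^(m*(d-2)) =
        1 + (1 - r) ^ ((2:ℝ) - d) *
          ∑ j ∈ Finset.Icc 1 m, (2:ℝ)^(j-1) * (2/r)^((d-2)*(j-1)) := by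
  intro m hm
  clear hm
  induction m with
  | zero => simp
  | succ n ih =>
    rw [Finset.sum_Icc_succ_top (by omega), mul_add, ← add_assoc, ← ih, Nat.add_sub_cancel,
      Nat.succ_mul, pow_add, pow_succ, Nat.mul_comm (d - 2) n]
    linear_combination (2:ℝ) ^ n * (2 / r) ^ (n * (d - 2)) * h1
end

section
/- Let d ≥ 3 be an integer, m a positive integer, and c > 0 a real. Let r_d ∈ (0,1) be the unique solution of 2(2/r)^{d-2} = 1 + (1-r)^{2-d}. Then there exists r ∈ (r_d, 1) satisfying 2^m (2/r)^{m(d-2)} - (1-r)^{2-d} · Σ_{j=1}^m 2^{j-1} (2/r)^{(d-2)(j-1)} - 1 = -c. -/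
/-- The level-`m` left-hand side factors through the level-one combination `x - 1 - A`
with `x = 2 * y ^ n`. -/
theorem level_eq_mul_geom_sum (y A : ℝ) (n m : ℕ) :
    (2:ℝ)^m * y^(m*n) - A * (∑ j ∈ Finset.Icc 1 m, (2:ℝ)^(j-1) * y^(n*(j-1))) - 1 =
      (2 * y^n - 1 - A) * ∑ j ∈ Finset.range m, (2 * y^n)^j := by
  have hsum : (∑ j ∈ Finset.Icc 1 m, (2:ℝ)^(j-1) * y^(n*(j-1))) =
      ∑ j ∈ Finset.range m, (2 * y^n)^j := by
    rw [← Finset.Ico_add_one_right_eq_Icc, Finset.sum_Ico_eq_sum_range]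
    simp [mul_pow, pow_mul]
  rw [hsum, sub_mul, mul_geom_sum, mul_pow, mul_comm m n, pow_mul]
  ring

/-- With bulk entropy constant `c > 0`, the level-`m` reconstruction-wedge
equation `2^m (2/r)^(m(d-2)) - (1-r)^(2-d) ∑_{j=1}^m 2^(j-1) (2/r)^((d-2)(j-1)) - 1 = -c`
has a solution `r` strictly between the bulk-entropy-free critical ratio `r_d` and `1`. -/
theorem stmt16 (d : ℕ) (hd : 3 ≤ d) (m : ℕ) (hm : 0 < m) (c : ℝ) (hc : 0 < c)
    (rd : ℝ) (hrd : rd ∈ Set.Ioo (0:ℝ) 1)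
    (hrdeq : 2 * (2/rd)^(d-2) = 1 + (1 - rd) ^ ((2:ℝ) - d)) :
    ∃ r ∈ Set.Ioo rd 1,
      (2:ℝ)^m * (2/r)^(m*(d-2)) -
        (1 - r) ^ ((2:ℝ) - d) *
          (∑ j ∈ Finset.Icc 1 m, (2:ℝ)^(j-1) * (2/r)^((d-2)*(j-1))) - 1 = -c := by
  obtain ⟨n, rfl⟩ : ∃ n, d = n + 2 := ⟨d - 2, by omega⟩
  have hn : n ≠ 0 := by omega
  obtain ⟨h0, h1⟩ := hrd
  have hA (r : ℝ) (hr : r < 1) : (1 - r) ^ ((2:ℝ) - (n + 2 : ℕ)) = ((1 - r)⁻¹)^n := by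
    rw [show (2:ℝ) - (n + 2 : ℕ) = -(n:ℝ) by push_cast; ring,
      Real.rpow_neg (by linarith), Real.rpow_natCast, inv_pow]
  simp only [level_eq_mul_geom_sum, Nat.add_sub_cancel] at hrdeq ⊢
  rw [hA rd h1] at hrdeq
  set X : ℝ := 2 * (2/rd)^n with hX
  let f : ℝ → ℝ := fun r ↦
    (2 * (2/r)^n - 1 - ((1 - r)⁻¹)^n) * ∑ j ∈ Finset.range m, (2 * (2/r)^n)^j
  have hinv : 1 ≤ (1 - rd)⁻¹ := (one_le_inv₀ (by linarith)).2 (by linarith)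
  have hXge : 1 + (1 - rd)⁻¹ ≤ X := by
    rw [hrdeq]
    gcongr
    exact le_self_pow₀ hinv hn
  have hXc : 0 < X + c := by linarith
  set s : ℝ := 1 - (X + c)⁻¹ with hs
  have hs1 : s < 1 := by linarith [inv_pos.2 hXc]
  have hrs : rd < s := by
    have : (X + c)⁻¹ < 1 - rd := (inv_lt_comm₀ hXc (by linarith)).2 (by linarith)
    linarith
  have hfrd : f rd = 0 := by
    have : 2 * (2/rd)^n - 1 - ((1 - rd)⁻¹)^n = 0 := by rw [← hX, hrdeq]; ring
    simp only [f, this, zero_mul]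
  have hfs : f s ≤ -c := by
    have hs0 : 0 < s := h0.trans hrs
    have hx : 2 * (2/s)^n ≤ X := by
      rw [hX]
      gcongr
    have hAs : X + c ≤ ((1 - s)⁻¹)^n := by
      rw [hs, sub_sub_cancel, inv_inv]
      exact le_self_pow₀ (by linarith) hn
    have hS : 1 ≤ ∑ j ∈ Finset.range m, (2 * (2/s)^n)^j := by
      have := Finset.single_le_sum (f := fun j ↦ (2 * (2/s)^n)^j)
        (fun j _ ↦ by positivity) (Finset.mem_range.2 hm)
      simpa using this
    change _ * _ ≤ _
    nlinarith
  have hcont : ContinuousOn f (Set.Icc rd s) := by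
    have hid : ContinuousOn (fun r : ℝ ↦ 2 / r) (Set.Icc rd s) :=
      continuousOn_const.div continuousOn_id fun r hr ↦ (h0.trans_le hr.1).ne'
    have hsub : ContinuousOn (fun r : ℝ ↦ (1 - r)⁻¹) (Set.Icc rd s) :=
      (by fun_prop : ContinuousOn (fun r : ℝ ↦ 1 - r) _).inv₀
        fun r hr ↦ (sub_pos.2 (hr.2.trans_lt hs1)).ne'
    fun_prop
  obtain ⟨r, ⟨hr1, hr2⟩, hfr⟩ :=
    intermediate_value_Icc' hrs.le hcont ⟨hfs, by rw [hfrd]; linarith⟩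
  have hne : rd ≠ r := by
    rintro rfl
    linarith
  refine ⟨r, ⟨lt_of_le_of_ne hr1 hne, hr2.trans_lt hs1⟩, ?_⟩
  rw [hA r (hr2.trans_lt hs1)]
  exact hfr
end
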